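/- arXiv:1106.4372 — 3 statements merged into one kernel-verified Lean document; each statement's English description precedes it below -/
import Mathlib

section
/- For each μ ∈ {0,1,2,3}, the function ζ̂_μ satisfies the hyperbolic harmonic equation □ζ̂_μ + 3ζ̂_μ = 0 at every point of U, where □Φ = -∂²_τΦ - 2 tanhτ ∂_τΦ + sech²τ (∂²_θΦ + cotθ ∂_θΦ + sin⁻²θ ∂²_φΦ). -/
noncomputable section

/-- Points of the chart `U = ℝ × (0,π) × ℝ` with coordinates `(τ, θ, φ)`. -/
abbrev Pt : Type := Fin 3 → ℝ

/-- The coordinate domain `U = ℝ × (0,π) × ℝ`. -/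
def U : Set Pt := {x | 0 < x 1 ∧ x 1 < Real.pi}

/-- Partial derivative `∂_i f` at `x`. -/
noncomputable def pd (i : Fin 3) (f : Pt → ℝ) (x : Pt) : ℝ :=
  deriv (fun t => f (Function.update x i t)) (x i)

/-- The unit-hyperboloid (dS₃) metric `h⁰_{ab}`. -/
noncomputable def h0 (x : Pt) : Fin 3 → Fin 3 → ℝ :=
  ![![-1, 0, 0],
    ![0, Real.cosh (x 0) ^ 2, 0],
    ![0, 0, Real.cosh (x 0) ^ 2 * Real.sin (x 1) ^ 2]]

/-- The inverse metric `h⁰^{ab}`. -/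
noncomputable def h0inv (x : Pt) : Fin 3 → Fin 3 → ℝ :=
  ![![-1, 0, 0],
    ![0, 1 / Real.cosh (x 0) ^ 2, 0],
    ![0, 0, 1 / (Real.cosh (x 0) ^ 2 * Real.sin (x 1) ^ 2)]]

/-- Christoffel symbols `Γ^c_{ab}` of `h⁰`; first index is the upper index. -/
noncomputable def Chr (x : Pt) : Fin 3 → Fin 3 → Fin 3 → ℝ :=
  ![![![0, 0, 0],
      ![0, Real.sinh (x 0) * Real.cosh (x 0), 0],
      ![0, 0, Real.sinh (x 0) * Real.cosh (x 0) * Real.sin (x 1) ^ 2]],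
    ![![0, Real.tanh (x 0), 0],
      ![Real.tanh (x 0), 0, 0],
      ![0, 0, -(Real.sin (x 1) * Real.cos (x 1))]],
    ![![0, 0, Real.tanh (x 0)],
      ![0, 0, Real.cos (x 1) / Real.sin (x 1)],
      ![Real.tanh (x 0), Real.cos (x 1) / Real.sin (x 1), 0]]]

/-- Covariant Hessian `D_a D_b f = ∂_a ∂_b f - Σ_c Γ^c_{ab} ∂_c f`. -/
noncomputable def hess (f : Pt → ℝ) (x : Pt) (a b : Fin 3) : ℝ :=
  pd a (pd b f) x - ∑ c, Chr x c a b * pd c f x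

/-- Covariant derivative `D_c T_{ab}` of a 2-tensor. -/
noncomputable def covD (T : Pt → Fin 3 → Fin 3 → ℝ) (x : Pt) (c a b : Fin 3) : ℝ :=
  pd c (fun y => T y a b) x - (∑ d, Chr x d c a * T x d b) - (∑ d, Chr x d c b * T x a d)

/-- Second covariant derivative `D_d D_c T_{ab}`, treating `D_c T_{ab}` as a 3-tensor. -/
noncomputable def covD2 (T : Pt → Fin 3 → Fin 3 → ℝ) (x : Pt) (d c a b : Fin 3) : ℝ :=
  pd d (fun y => covD T y c a b) x
    - (∑ e, Chr x e d c * covD T x e a b)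
    - (∑ e, Chr x e d a * covD T x c e b)
    - (∑ e, Chr x e d b * covD T x c a e)

/-- Tensor Laplacian `□T_{ab} = Σ_{c,d} h⁰^{cd} D_d D_c T_{ab}`. -/
noncomputable def boxT (T : Pt → Fin 3 → Fin 3 → ℝ) (x : Pt) (a b : Fin 3) : ℝ :=
  ∑ c, ∑ d, h0inv x c d * covD2 T x d c a b

/-- Totally antisymmetric Levi-Civita symbol with `levi 0 1 2 = 1`. -/
def levi : Fin 3 → Fin 3 → Fin 3 → ℝ :=
  ![![![0, 0, 0], ![0, 0, 1], ![0, -1, 0]],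
    ![![0, 0, -1], ![0, 0, 0], ![1, 0, 0]],
    ![![0, 1, 0], ![-1, 0, 0], ![0, 0, 0]]]

/-- Volume tensor `ε_{abc}` with `ε_{τθφ} = cosh²τ sinθ`. -/
noncomputable def epsLow (x : Pt) (a b c : Fin 3) : ℝ :=
  levi a b c * (Real.cosh (x 0) ^ 2 * Real.sin (x 1))

/-- `ε_a{}^{cd} = Σ_{e,f} ε_{aef} h⁰^{ec} h⁰^{fd}`. -/
noncomputable def epsMixed (x : Pt) (a c d : Fin 3) : ℝ :=
  ∑ e, ∑ f, epsLow x a e f * h0inv x e c * h0inv x f d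

/-- Curl of a 2-tensor: `(curl T)_{ab} = Σ_{c,d} ε_a{}^{cd} D_c T_{db}`. -/
noncomputable def curlT (T : Pt → Fin 3 → Fin 3 → ℝ) (x : Pt) (a b : Fin 3) : ℝ :=
  ∑ c, ∑ d, epsMixed x a c d * covD T x c d b

/-- The other set of lowest harmonics `ζ̂_μ`. -/
noncomputable def zetaHat : Fin 4 → Pt → ℝ :=
  ![fun x => Real.cosh (2 * x 0) / Real.cosh (x 0),
    fun x => (2 * Real.sinh (x 0) + Real.tanh (x 0) / Real.cosh (x 0)) * Real.cos (x 1),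
    fun x => (2 * Real.sinh (x 0) + Real.tanh (x 0) / Real.cosh (x 0)) * Real.sin (x 1) * Real.cos (x 2),
    fun x => (2 * Real.sinh (x 0) + Real.tanh (x 0) / Real.cosh (x 0)) * Real.sin (x 1) * Real.sin (x 2)]

/-- Scalar Laplacian of `h⁰` in explicit coordinate form:
`□Φ = -∂²_τΦ - 2 tanhτ ∂_τΦ + sech²τ (∂²_θΦ + cotθ ∂_θΦ + sin⁻²θ ∂²_φΦ)`. -/
noncomputable def boxS (f : Pt → ℝ) (x : Pt) : ℝ :=
  -(pd 0 (pd 0 f) x) - 2 * Real.tanh (x 0) * pd 0 f x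
    + (1 / Real.cosh (x 0) ^ 2) *
      (pd 1 (pd 1 f) x + (Real.cos (x 1) / Real.sin (x 1)) * pd 1 f x
        + (1 / Real.sin (x 1) ^ 2) * pd 2 (pd 2 f) x)

/-- The partial derivatives of a function that is a product of functions of one coordinate each. -/
lemma pd_zero_mul {a a' b c : ℝ → ℝ} (ha : ∀ t, HasDerivAt a (a' t) t) :
    pd 0 (fun x => a (x 0) * b (x 1) * c (x 2)) = fun x => a' (x 0) * b (x 1) * c (x 2) := by
  funext x
  simpa [pd] using (((ha (x 0)).mul_const (b (x 1))).mul_const (c (x 2))).deriv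

lemma pd_one_mul {a b b' c : ℝ → ℝ} (hb : ∀ t, HasDerivAt b (b' t) t) :
    pd 1 (fun x => a (x 0) * b (x 1) * c (x 2)) = fun x => a (x 0) * b' (x 1) * c (x 2) := by
  funext x
  simpa [pd] using (((hb (x 1)).const_mul (a (x 0))).mul_const (c (x 2))).deriv

lemma pd_two_mul {a b c c' : ℝ → ℝ} (hc : ∀ t, HasDerivAt c (c' t) t) :
    pd 2 (fun x => a (x 0) * b (x 1) * c (x 2)) = fun x => a (x 0) * b (x 1) * c' (x 2) := by
  funext x
  simpa [pd] using ((hc (x 2)).const_mul (a (x 0) * b (x 1))).deriv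

/-- The Laplacian of a function that is a product of functions of one coordinate each. -/
lemma boxS_mul {a a' a'' b b' b'' c c' c'' : ℝ → ℝ}
    (ha : ∀ t, HasDerivAt a (a' t) t) (ha' : ∀ t, HasDerivAt a' (a'' t) t)
    (hb : ∀ t, HasDerivAt b (b' t) t) (hb' : ∀ t, HasDerivAt b' (b'' t) t)
    (hc : ∀ t, HasDerivAt c (c' t) t) (hc' : ∀ t, HasDerivAt c' (c'' t) t) (x : Pt) :
    boxS (fun x => a (x 0) * b (x 1) * c (x 2)) x =
      -(a'' (x 0) * b (x 1) * c (x 2))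
        - 2 * Real.tanh (x 0) * (a' (x 0) * b (x 1) * c (x 2))
        + (1 / Real.cosh (x 0) ^ 2) *
          (a (x 0) * b'' (x 1) * c (x 2)
            + (Real.cos (x 1) / Real.sin (x 1)) * (a (x 0) * b' (x 1) * c (x 2))
            + (1 / Real.sin (x 1) ^ 2) * (a (x 0) * b (x 1) * c'' (x 2))) := by
  simp only [boxS, pd_zero_mul ha, pd_zero_mul ha', pd_one_mul hb, pd_one_mul hb',
    pd_two_mul hc, pd_two_mul hc']

lemma hasDerivAt_cosh_two_mul_div_cosh (t : ℝ) :
    HasDerivAt (fun t => Real.cosh (2 * t) / Real.cosh t)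
      (2 * Real.sinh t + Real.tanh t / Real.cosh t) t := by
  have h := (Real.cosh_pos t).ne'
  have hs := Real.cosh_sq t
  have h2 : HasDerivAt (fun t : ℝ => 2 * t) 2 t := by simpa using (hasDerivAt_id t).const_mul 2
  refine (h2.cosh.div (Real.hasDerivAt_cosh t) h).congr_deriv ?_
  rw [Real.tanh_eq_sinh_div_cosh, Real.sinh_two_mul, Real.cosh_two_mul]
  field_simp
  linear_combination Real.sinh t * hs

lemma hasDerivAt_two_mul_sinh_add (t : ℝ) :
    HasDerivAt (fun t => 2 * Real.sinh t + Real.tanh t / Real.cosh t)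
      (2 * Real.cosh t - 1 / Real.cosh t + 2 / Real.cosh t ^ 3) t := by
  have h := (Real.cosh_pos t).ne'
  have hs := Real.cosh_sq t
  simp only [Real.tanh_eq_sinh_div_cosh]
  refine (((Real.hasDerivAt_sinh t).const_mul 2).add
    (((Real.hasDerivAt_sinh t).div (Real.hasDerivAt_cosh t) h).div
      (Real.hasDerivAt_cosh t) h)).congr_deriv ?_
  rw [Pi.div_apply]
  field_simp
  linear_combination 2 * hs

lemma hasDerivAt_two_mul_cosh_sub_add (t : ℝ) :
    HasDerivAt (fun t => 2 * Real.cosh t - 1 / Real.cosh t + 2 / Real.cosh t ^ 3)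
      (2 * Real.sinh t + Real.sinh t / Real.cosh t ^ 2 - 6 * Real.sinh t / Real.cosh t ^ 4) t := by
  have h := (Real.cosh_pos t).ne'
  refine ((((Real.hasDerivAt_cosh t).const_mul 2).sub
    ((hasDerivAt_const t 1).div (Real.hasDerivAt_cosh t) h)).add
    ((hasDerivAt_const t 2).div ((Real.hasDerivAt_cosh t).pow 3)
      (pow_ne_zero 3 h))).congr_deriv ?_
  simp
  field_simp
  ring

/-- The radial equation of the degree-zero harmonic. -/
lemma radial_eq_zero (t : ℝ) :
    -(2 * Real.cosh t - 1 / Real.cosh t + 2 / Real.cosh t ^ 3)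
      - 2 * Real.tanh t * (2 * Real.sinh t + Real.tanh t / Real.cosh t)
      + 3 * (Real.cosh (2 * t) / Real.cosh t) = 0 := by
  have h := (Real.cosh_pos t).ne'
  rw [Real.tanh_eq_sinh_div_cosh, Real.cosh_two_mul]
  field_simp
  rw [Real.sinh_sq]
  ring

/-- The radial equation of the degree-one harmonics. -/
lemma radial_eq_one (t : ℝ) :
    -(2 * Real.sinh t + Real.sinh t / Real.cosh t ^ 2 - 6 * Real.sinh t / Real.cosh t ^ 4)
      - 2 * Real.tanh t * (2 * Real.cosh t - 1 / Real.cosh t + 2 / Real.cosh t ^ 3)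
      - 2 / Real.cosh t ^ 2 * (2 * Real.sinh t + Real.tanh t / Real.cosh t)
      + 3 * (2 * Real.sinh t + Real.tanh t / Real.cosh t) = 0 := by
  have h := (Real.cosh_pos t).ne'
  rw [Real.tanh_eq_sinh_div_cosh]
  field_simp
  ring

/-- A product of the degree-one radial function with a degree-one spherical harmonic satisfies
`□Φ + 3Φ = 0`. -/
lemma boxS_add_three_mul_eq_zero {b b' b'' c c' c'' : ℝ → ℝ}
    (hb : ∀ t, HasDerivAt b (b' t) t) (hb' : ∀ t, HasDerivAt b' (b'' t) t)
    (hc : ∀ t, HasDerivAt c (c' t) t) (hc' : ∀ t, HasDerivAt c' (c'' t) t) (x : Pt)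
    (h : b'' (x 1) * c (x 2) + (Real.cos (x 1) / Real.sin (x 1)) * (b' (x 1) * c (x 2))
      + (1 / Real.sin (x 1) ^ 2) * (b (x 1) * c'' (x 2)) = -2 * (b (x 1) * c (x 2))) :
    boxS (fun x => (2 * Real.sinh (x 0) + Real.tanh (x 0) / Real.cosh (x 0)) * b (x 1) * c (x 2)) x
      + 3 * ((2 * Real.sinh (x 0) + Real.tanh (x 0) / Real.cosh (x 0)) * b (x 1) * c (x 2)) = 0 := by
  rw [boxS_mul hasDerivAt_two_mul_sinh_add hasDerivAt_two_mul_cosh_sub_add hb hb' hc hc']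
  linear_combination (b (x 1) * c (x 2)) * radial_eq_one (x 0)
    + (1 / Real.cosh (x 0) ^ 2) * (2 * Real.sinh (x 0) + Real.tanh (x 0) / Real.cosh (x 0)) * h

/-- For each `μ ∈ {0,1,2,3}`, `□ζ̂_μ + 3ζ̂_μ = 0` on `U`. -/
theorem stmt2 : ∀ μ : Fin 4, ∀ x ∈ U, boxS (zetaHat μ) x + 3 * zetaHat μ x = 0 := by
  intro μ x hx
  have hs : Real.sin (x 1) ≠ 0 := (Real.sin_pos_of_pos_of_lt_pi hx.1 hx.2).ne'
  have hcs := Real.cos_sq' (x 1)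
  have hconst (k t : ℝ) : HasDerivAt (fun _ : ℝ => k) 0 t := hasDerivAt_const t k
  have hneg_sin (t : ℝ) : HasDerivAt (fun t => -Real.sin t) (-Real.cos t) t :=
    (Real.hasDerivAt_sin t).neg
  fin_cases μ
  · have h := boxS_mul hasDerivAt_cosh_two_mul_div_cosh hasDerivAt_two_mul_sinh_add
      (hconst 1) (hconst 0) (hconst 1) (hconst 0) x
    simp only [mul_one, mul_zero, add_zero] at h
    simpa [zetaHat, h] using radial_eq_zero (x 0)
  · have h := boxS_add_three_mul_eq_zero Real.hasDerivAt_cos hneg_sin (hconst 1) (hconst 0) x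
      (by field_simp; ring)
    simpa [zetaHat] using h
  · exact boxS_add_three_mul_eq_zero Real.hasDerivAt_sin Real.hasDerivAt_cos
      Real.hasDerivAt_cos hneg_sin x (by field_simp; rw [hcs]; ring)
  · exact boxS_add_three_mul_eq_zero Real.hasDerivAt_sin Real.hasDerivAt_cos
      Real.hasDerivAt_sin Real.hasDerivAt_cos x (by field_simp; rw [hcs]; ring)
end
end

section
/- For every smooth function ω : U → ℝ, the symmetric tensor T_{ab} = D_aD_bω + h⁰_{ab}ω has vanishing curl: (curl T)_{ab} = Σ_{c,d} ε_a{}^{cd} D_c T_{db} = 0 at every point of U and for all indices a,b. -/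
noncomputable section

theorem isOpen_U : IsOpen U :=
  (isOpen_lt continuous_const (continuous_apply 1)).inter
    (isOpen_lt (continuous_apply 1) continuous_const)

theorem hasDerivAt_update_eq_fderiv {f : Pt → ℝ} {x : Pt} (hf : DifferentiableAt ℝ f x)
    (i : Fin 3) :
    HasDerivAt (fun t => f (Function.update x i t)) (fderiv ℝ f x (Pi.single i 1)) (x i) := by
  have h := hasDerivAt_update x i (x i)
  refine HasFDerivAt.comp_hasDerivAt (x i) ?_ h
  rw [Function.update_eq_self]
  exact hf.hasFDerivAt

theorem pd_eq_fderiv {f : Pt → ℝ} {x : Pt} (hf : DifferentiableAt ℝ f x) (i : Fin 3) :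
    pd i f x = fderiv ℝ f x (Pi.single i 1) :=
  (hasDerivAt_update_eq_fderiv hf i).deriv

theorem hasDerivAt_update_pd {f : Pt → ℝ} {x : Pt} (hf : DifferentiableAt ℝ f x) (i : Fin 3) :
    HasDerivAt (fun t => f (Function.update x i t)) (pd i f x) (x i) :=
  pd_eq_fderiv hf i ▸ hasDerivAt_update_eq_fderiv hf i

theorem differentiableAt_of_smoothOn_U {f : Pt → ℝ} (hf : ContDiffOn ℝ (⊤ : ℕ∞) f U) {x : Pt}
    (hx : x ∈ U) : DifferentiableAt ℝ f x :=
  (hf.contDiffAt (isOpen_U.mem_nhds hx)).differentiableAt (by simp)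

theorem contDiffOn_pd {f : Pt → ℝ} (hf : ContDiffOn ℝ (⊤ : ℕ∞) f U) (i : Fin 3) :
    ContDiffOn ℝ (⊤ : ℕ∞) (pd i f) U := by
  have h : ContDiffOn ℝ (⊤ : ℕ∞) (fderiv ℝ f) U := hf.fderiv_of_isOpen isOpen_U (by simp)
  exact (h.clm_apply contDiffOn_const).congr fun y hy =>
    pd_eq_fderiv (differentiableAt_of_smoothOn_U hf hy) i

theorem pd_congr {f g : Pt → ℝ} {x : Pt} (hx : x ∈ U) (h : ∀ y ∈ U, f y = g y) (i : Fin 3) :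
    pd i f x = pd i g x := by
  refine Filter.EventuallyEq.deriv_eq ?_
  have hc : Filter.Tendsto (fun t => Function.update x i t) (nhds (x i)) (nhds x) := by
    have h := (hasDerivAt_update x i (x i)).continuousAt.tendsto
    rwa [Function.update_eq_self] at h
  filter_upwards [hc (isOpen_U.mem_nhds hx)] with t ht using h _ ht

theorem pd_comm {f : Pt → ℝ} (hf : ContDiffOn ℝ (⊤ : ℕ∞) f U) {x : Pt} (hx : x ∈ U)
    (i j : Fin 3) : pd i (pd j f) x = pd j (pd i f) x := by
  have hd : DifferentiableAt ℝ (fderiv ℝ f) x :=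
    ((hf.fderiv_of_isOpen (m := (⊤ : ℕ∞)) isOpen_U (by simp)).contDiffAt
      (isOpen_U.mem_nhds hx)).differentiableAt (by simp)
  have key (i j : Fin 3) : pd i (pd j f) x =
      fderiv ℝ (fderiv ℝ f) x (Pi.single i 1) (Pi.single j 1) := by
    rw [pd_congr hx fun y hy => pd_eq_fderiv (differentiableAt_of_smoothOn_U hf hy) j,
      pd_eq_fderiv (hd.clm_apply (differentiableAt_const _)), fderiv_clm_apply hd (by fun_prop)]
    simp
  have hs : IsSymmSndFDerivAt ℝ f x :=
    (hf.contDiffAt (isOpen_U.mem_nhds hx)).isSymmSndFDerivAt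
      (by simpa using WithTop.coe_le_coe.mpr (le_top : (2 : ℕ∞) ≤ ⊤))
  rw [key, key, hs.eq]

/-- Partial derivatives `∂_k h⁰_{ab}` of the metric. -/
def dh0 (x : Pt) : Fin 3 → Fin 3 → Fin 3 → ℝ :=
  ![![![0, 0, 0],
      ![0, 2 * Real.cosh (x 0) * Real.sinh (x 0), 0],
      ![0, 0, 2 * Real.cosh (x 0) * Real.sinh (x 0) * Real.sin (x 1) ^ 2]],
    ![![0, 0, 0],
      ![0, 0, 0],
      ![0, 0, Real.cosh (x 0) ^ 2 * (2 * Real.sin (x 1) * Real.cos (x 1))]],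
    0]

/-- Partial derivatives `∂_k Γ^c_{ab}` of the Christoffel symbols, indexed as `k c a b`. -/
def dChr (x : Pt) : Fin 3 → Fin 3 → Fin 3 → Fin 3 → ℝ :=
  ![![![![0, 0, 0],
        ![0, Real.cosh (x 0) ^ 2 + Real.sinh (x 0) ^ 2, 0],
        ![0, 0, (Real.cosh (x 0) ^ 2 + Real.sinh (x 0) ^ 2) * Real.sin (x 1) ^ 2]],
      ![![0, 1 - Real.tanh (x 0) ^ 2, 0],
        ![1 - Real.tanh (x 0) ^ 2, 0, 0],
        ![0, 0, 0]],
      ![![0, 0, 1 - Real.tanh (x 0) ^ 2],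
        ![0, 0, 0],
        ![1 - Real.tanh (x 0) ^ 2, 0, 0]]],
    ![![![0, 0, 0],
        ![0, 0, 0],
        ![0, 0, Real.sinh (x 0) * Real.cosh (x 0) * (2 * Real.sin (x 1) * Real.cos (x 1))]],
      ![![0, 0, 0],
        ![0, 0, 0],
        ![0, 0, Real.sin (x 1) ^ 2 - Real.cos (x 1) ^ 2]],
      ![![0, 0, 0],
        ![0, 0, -1 - (Real.cos (x 1) / Real.sin (x 1)) ^ 2],
        ![0, -1 - (Real.cos (x 1) / Real.sin (x 1)) ^ 2, 0]]],
    0]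

theorem hasDerivAt_tanh_sub (t : ℝ) : HasDerivAt Real.tanh (1 - Real.tanh t ^ 2) t := by
  have h := (Real.hasDerivAt_sinh t).div (Real.hasDerivAt_cosh t) (Real.cosh_pos t).ne'
  have he : Real.tanh = Real.sinh / Real.cosh := funext Real.tanh_eq_sinh_div_cosh
  rw [he]
  refine h.congr_deriv ?_
  have := (Real.cosh_pos t).ne'
  rw [Pi.div_apply]
  field_simp

theorem hasDerivAt_cot_sub {t : ℝ} (ht : Real.sin t ≠ 0) :
    HasDerivAt (fun s => Real.cos s / Real.sin s) (-1 - (Real.cos t / Real.sin t) ^ 2) t := by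
  refine ((Real.hasDerivAt_cos t).div (Real.hasDerivAt_sin t) ht).congr_deriv ?_
  field_simp

theorem hasDerivAt_h0_update (x : Pt) (k a b : Fin 3) :
    HasDerivAt (fun t => h0 (Function.update x k t) a b) (dh0 x k a b) (x k) := by
  have hC := (Real.hasDerivAt_cosh (x 0)).fun_pow 2
  have hs := (Real.hasDerivAt_sin (x 1)).fun_pow 2
  fin_cases k <;> fin_cases a <;> fin_cases b <;>
    simp [h0, dh0, hasDerivAt_const]
  · simpa using hC
  · simpa using hC.mul_const (Real.sin (x 1) ^ 2)
  · simpa using hs.const_mul (Real.cosh (x 0) ^ 2)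

theorem hasDerivAt_Chr_update {x : Pt} (hx : x ∈ U) (k c a b : Fin 3) :
    HasDerivAt (fun t => Chr (Function.update x k t) c a b) (dChr x k c a b) (x k) := by
  have hsin : Real.sin (x 1) ≠ 0 := (Real.sin_pos_of_pos_of_lt_pi hx.1 hx.2).ne'
  have hSC : HasDerivAt (fun t => Real.sinh t * Real.cosh t)
      (Real.cosh (x 0) ^ 2 + Real.sinh (x 0) ^ 2) (x 0) := by
    refine ((Real.hasDerivAt_sinh (x 0)).mul (Real.hasDerivAt_cosh (x 0))).congr_deriv ?_
    ring
  have hs := (Real.hasDerivAt_sin (x 1)).fun_pow 2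
  have hsc : HasDerivAt (fun t => -(Real.sin t * Real.cos t))
      (Real.sin (x 1) ^ 2 - Real.cos (x 1) ^ 2) (x 1) := by
    refine ((Real.hasDerivAt_sin (x 1)).mul (Real.hasDerivAt_cos (x 1))).neg.congr_deriv ?_
    ring
  have hT := hasDerivAt_tanh_sub (x 0)
  have hcot := hasDerivAt_cot_sub hsin
  fin_cases k <;> fin_cases c <;> fin_cases a <;> fin_cases b <;>
    simp [Chr, dChr, hasDerivAt_const] <;>
    first
      | assumption
      | simpa using hSC.mul_const (Real.sin (x 1) ^ 2)
      | simpa using hs.const_mul (Real.sinh (x 0) * Real.cosh (x 0))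

theorem pd_hess_add {ω : Pt → ℝ} (hω : ContDiffOn ℝ (⊤ : ℕ∞) ω U) {x : Pt} (hx : x ∈ U)
    (k a b : Fin 3) :
    pd k (fun y => hess ω y a b + h0 y a b * ω y) x =
      pd k (pd a (pd b ω)) x
        - ∑ e, (dChr x k e a b * pd e ω x + Chr x e a b * pd k (pd e ω) x)
        + (dh0 x k a b * ω x + h0 x a b * pd k ω x) := by
  have h3 := hasDerivAt_update_pd (differentiableAt_of_smoothOn_U
    (contDiffOn_pd (contDiffOn_pd hω b) a) hx) k
  have h2 (e : Fin 3) := hasDerivAt_update_pd (differentiableAt_of_smoothOn_U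
    (contDiffOn_pd hω e) hx) k
  have h1 := hasDerivAt_update_pd (differentiableAt_of_smoothOn_U hω hx) k
  have h := (h3.sub (HasDerivAt.fun_sum fun e (_ : e ∈ Finset.univ) =>
    (hasDerivAt_Chr_update hx k e a b).mul (h2 e))).add ((hasDerivAt_h0_update x k a b).mul h1)
  refine Eq.trans ?_ (h.deriv.trans ?_)
  · congr 1
  · simp only [Function.update_eq_self]

theorem covD_hess_add_symm {ω : Pt → ℝ} (hω : ContDiffOn ℝ (⊤ : ℕ∞) ω U) {x : Pt} (hx : x ∈ U)
    (c d b : Fin 3) :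
    covD (fun y a' b' => hess ω y a' b' + h0 y a' b' * ω y) x c d b =
      covD (fun y a' b' => hess ω y a' b' + h0 y a' b' * ω y) x d c b := by
  have hsin : Real.sin (x 1) ≠ 0 := (Real.sin_pos_of_pos_of_lt_pi hx.1 hx.2).ne'
  have hcosh : Real.cosh (x 0) ≠ 0 := (Real.cosh_pos _).ne'
  have hS : Real.cosh (x 0) ^ 2 = Real.sinh (x 0) ^ 2 + 1 := Real.cosh_sq _
  have hs : Real.cos (x 1) ^ 2 = 1 - Real.sin (x 1) ^ 2 := Real.cos_sq' _
  have e10 := pd_comm hω hx 1 0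
  have e20 := pd_comm hω hx 2 0
  have e21 := pd_comm hω hx 2 1
  have e3 := pd_comm (contDiffOn_pd hω b) hx c d
  simp only [covD, pd_hess_add hω hx, e3]
  simp only [hess]
  fin_cases c <;> fin_cases d <;> fin_cases b <;>
    simp [Fin.sum_univ_three, Chr, dChr, h0, dh0, e10, e20, e21, Real.tanh_eq_sinh_div_cosh] <;>
    field_simp <;> grind

theorem epsMixed_antisymm (x : Pt) (a c d : Fin 3) : epsMixed x a c d = -epsMixed x a d c := by
  fin_cases a <;> fin_cases c <;> fin_cases d <;>
    simp [epsMixed, epsLow, levi, h0inv, Fin.sum_univ_three] <;> ring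

theorem curlT_eq_zero_of_symm {T : Pt → Fin 3 → Fin 3 → ℝ} {x : Pt} {b : Fin 3}
    (h : ∀ c d, covD T x c d b = covD T x d c b) (a : Fin 3) : curlT T x a b = 0 := by
  have hneg : curlT T x a b = -curlT T x a b := by
    conv_lhs => rw [curlT, Finset.sum_comm]
    simp only [curlT, ← Finset.sum_neg_distrib]
    refine Finset.sum_congr rfl fun c _ => Finset.sum_congr rfl fun d _ => ?_
    rw [epsMixed_antisymm, h]
    ring
  linarith

/-- For every smooth `ω`, the tensor `T_{ab} = D_aD_bω + h⁰_{ab}ω` has vanishing curl on `U`. -/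
theorem stmt4 : ∀ ω : Pt → ℝ, ContDiffOn ℝ (⊤ : ℕ∞) ω U →
    ∀ x ∈ U, ∀ a b : Fin 3,
      curlT (fun y a' b' => hess ω y a' b' + h0 y a' b' * ω y) x a b = 0 := by
  intro ω hω x hx a b
  exact curlT_eq_zero_of_symm (fun c d => covD_hess_add_symm hω hx c d b) a
end
end

section
/- For each μ ∈ {0,1,2,3} and every value of the parameter c ∈ ℝ, the singular representative k_{(μ)ab} is traceless, Σ_{a,b} h⁰^{ab} k_{(μ)ab} = 0, and divergence-free, D^b k_{(μ)ab} = Σ_{b,c} h⁰^{bc} D_c k_{(μ)ab} = 0, at every point of U. -/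
noncomputable section

/-- The singular representatives `k_{(μ)ab}` of the tensor potential, depending on the
parameter `c`.  Indices: `0 = τ`, `1 = θ`, `2 = φ`. -/
noncomputable def kk (c : ℝ) : Fin 4 → Pt → Fin 3 → Fin 3 → ℝ :=
  ![fun x =>
      ![![0, 0, 2 * (c - Real.cos (x 1)) / Real.cosh (x 0)],
        ![0, 0, Real.sinh (x 0) * (Real.cos (2 * x 1) - 4 * c * Real.cos (x 1) + 3) /
          (2 * Real.sin (x 1))],
        ![2 * (c - Real.cos (x 1)) / Real.cosh (x 0),
          Real.sinh (x 0) * (Real.cos (2 * x 1) - 4 * c * Real.cos (x 1) + 3) /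
            (2 * Real.sin (x 1)), 0]],
    fun x =>
      ![![0, 0, -3 * (Real.tanh (x 0) / Real.cosh (x 0)) * Real.sin (x 1) ^ 2],
        ![0, 0, Real.cosh (x 0) * (-8 * c + 9 * Real.cos (x 1) - Real.cos (3 * x 1)) /
          (4 * Real.sin (x 1))],
        ![-3 * (Real.tanh (x 0) / Real.cosh (x 0)) * Real.sin (x 1) ^ 2,
          Real.cosh (x 0) * (-8 * c + 9 * Real.cos (x 1) - Real.cos (3 * x 1)) /
            (4 * Real.sin (x 1)), 0]],
    fun x =>
      ![![0, 3 * (Real.tanh (x 0) / Real.cosh (x 0)) * Real.sin (x 2),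
          3 * (Real.tanh (x 0) / Real.cosh (x 0)) * Real.cos (x 1) * Real.sin (x 1) *
            Real.cos (x 2)],
        ![3 * (Real.tanh (x 0) / Real.cosh (x 0)) * Real.sin (x 2),
          Real.cosh (x 0) * Real.sin (x 2) *
            (8 * c - 9 * Real.cos (x 1) + Real.cos (3 * x 1)) / (2 * Real.sin (x 1) ^ 3),
          Real.cosh (x 0) * Real.cos (x 2) *
            (Real.cos (x 1) ^ 4 - 4 * c * Real.cos (x 1) + 3) / Real.sin (x 1) ^ 2],
        ![3 * (Real.tanh (x 0) / Real.cosh (x 0)) * Real.cos (x 1) * Real.sin (x 1) *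
            Real.cos (x 2),
          Real.cosh (x 0) * Real.cos (x 2) *
            (Real.cos (x 1) ^ 4 - 4 * c * Real.cos (x 1) + 3) / Real.sin (x 1) ^ 2,
          Real.cosh (x 0) * Real.sin (x 2) *
            (-8 * c + 9 * Real.cos (x 1) - Real.cos (3 * x 1)) / (2 * Real.sin (x 1))]],
    fun x =>
      ![![0, -3 * (Real.tanh (x 0) / Real.cosh (x 0)) * Real.cos (x 2),
          3 * (Real.tanh (x 0) / Real.cosh (x 0)) * Real.cos (x 1) * Real.sin (x 1) *
            Real.sin (x 2)],
        ![-3 * (Real.tanh (x 0) / Real.cosh (x 0)) * Real.cos (x 2),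
          Real.cosh (x 0) * Real.cos (x 2) *
            (-8 * c + 9 * Real.cos (x 1) - Real.cos (3 * x 1)) / (2 * Real.sin (x 1) ^ 3),
          Real.cosh (x 0) * Real.sin (x 2) *
            (Real.cos (x 1) ^ 4 - 4 * c * Real.cos (x 1) + 3) / Real.sin (x 1) ^ 2],
        ![3 * (Real.tanh (x 0) / Real.cosh (x 0)) * Real.cos (x 1) * Real.sin (x 1) *
            Real.sin (x 2),
          Real.cosh (x 0) * Real.sin (x 2) *
            (Real.cos (x 1) ^ 4 - 4 * c * Real.cos (x 1) + 3) / Real.sin (x 1) ^ 2,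
          Real.cosh (x 0) * Real.cos (x 2) *
            (8 * c - 9 * Real.cos (x 1) + Real.cos (3 * x 1)) / (2 * Real.sin (x 1))]]]

lemma pd_eq_const_mul {i : Fin 3} {f : Pt → ℝ} {x : Pt} {g : ℝ → ℝ} {g' : ℝ} (k : ℝ)
    (hg : HasDerivAt g g' (x i)) (h : ∀ s, f (Function.update x i s) = k * g s) :
    pd i f x = k * g' := by
  unfold pd
  rw [funext h]
  exact (hg.const_mul k).deriv

lemma pd_eq_zero_of_const {i : Fin 3} {f : Pt → ℝ} {x : Pt}
    (h : ∀ s, f (Function.update x i s) = f x) : pd i f x = 0 := by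
  unfold pd
  rw [funext h]
  exact deriv_const _ _

/-- The divergence of a 2-tensor in terms of its values and its partial derivatives. -/
lemma sum_h0inv_mul_covD {T : Pt → Fin 3 → Fin 3 → ℝ} {x : Pt}
    {d00 d01 d02 d10 d11 d12 d20 d21 d22 : ℝ}
    (h00 : pd 0 (fun y => T y 0 0) x = d00) (h01 : pd 1 (fun y => T y 0 1) x = d01)
    (h02 : pd 2 (fun y => T y 0 2) x = d02) (h10 : pd 0 (fun y => T y 1 0) x = d10)
    (h11 : pd 1 (fun y => T y 1 1) x = d11) (h12 : pd 2 (fun y => T y 1 2) x = d12)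
    (h20 : pd 0 (fun y => T y 2 0) x = d20) (h21 : pd 1 (fun y => T y 2 1) x = d21)
    (h22 : pd 2 (fun y => T y 2 2) x = d22) (a : Fin 3) :
    (∑ b, ∑ e, h0inv x b e * covD T x e a b) =
      ∑ b, h0inv x b b * (![![d00, d01, d02], ![d10, d11, d12], ![d20, d21, d22]] a b -
        (∑ e, Chr x e b a * T x e b) - ∑ e, Chr x e b b * T x a e) := by
  subst h00 h01 h02 h10 h11 h12 h20 h21 h22
  fin_cases a <;> simp [h0inv, covD, Fin.sum_univ_three]

lemma hasDerivAt_tanh_div_cosh (t : ℝ) :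
    HasDerivAt (fun s => Real.tanh s / Real.cosh s)
      ((Real.cosh t ^ 2 - 2 * Real.sinh t ^ 2) / Real.cosh t ^ 3) t := by
  have hC := (Real.cosh_pos t).ne'
  have h := (Real.hasDerivAt_sinh t).fun_div ((Real.hasDerivAt_cosh t).fun_pow 2)
    (pow_ne_zero 2 hC)
  have hf : (fun s => Real.tanh s / Real.cosh s) = fun s => Real.sinh s / Real.cosh s ^ 2 := by
    funext s
    rw [Real.tanh_eq_sinh_div_cosh, div_div, sq]
  rw [hf]
  refine h.congr_deriv ?_
  field_simp
  ring

lemma hasDerivAt_inv_cosh (t : ℝ) :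
    HasDerivAt (fun s => (Real.cosh s)⁻¹) (-Real.sinh t / Real.cosh t ^ 2) t :=
  (Real.hasDerivAt_cosh t).fun_inv (Real.cosh_pos t).ne'

lemma HasDerivAt.div_sin_pow {f : ℝ → ℝ} {f' h : ℝ} (hf : HasDerivAt f f' h)
    (hs : Real.sin h ≠ 0) (n : ℕ) :
    HasDerivAt (fun u => f u / Real.sin u ^ (n + 1))
      ((f' * Real.sin h - (n + 1) * f h * Real.cos h) / Real.sin h ^ (n + 2)) h := by
  refine (hf.fun_div ((Real.hasDerivAt_sin h).fun_pow (n + 1)) (pow_ne_zero _ hs)).congr_deriv ?_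
  simp only [Nat.add_sub_cancel]
  push_cast
  field_simp
  ring

lemma hasDerivAt_cos_quadratic (c h : ℝ) :
    HasDerivAt (fun u => Real.cos (2 * u) - 4 * c * Real.cos u + 3)
      (4 * Real.sin h * (c - Real.cos h)) h := by
  have h2 : (fun u => Real.cos (2 * u) - 4 * c * Real.cos u + 3) =
      fun u => 2 * Real.cos u ^ 2 - 4 * c * Real.cos u + 2 := by
    funext u
    rw [Real.cos_two_mul]
    ring
  rw [h2]
  refine (((((Real.hasDerivAt_cos h).fun_pow 2).const_mul 2).fun_sub
    ((Real.hasDerivAt_cos h).const_mul (4 * c))).add_const 2).congr_deriv ?_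
  norm_num
  ring

lemma hasDerivAt_cos_cubic (c h : ℝ) :
    HasDerivAt (fun u => -8 * c + 9 * Real.cos u - Real.cos (3 * u))
      (-12 * Real.sin h ^ 3) h := by
  have h3 : (fun u => -8 * c + 9 * Real.cos u - Real.cos (3 * u)) =
      fun u => -8 * c + 12 * Real.cos u - 4 * Real.cos u ^ 3 := by
    funext u
    rw [Real.cos_three_mul]
    ring
  rw [h3]
  refine ((((Real.hasDerivAt_cos h).const_mul 12).const_add (-8 * c)).fun_sub
    (((Real.hasDerivAt_cos h).fun_pow 3).const_mul 4)).congr_deriv ?_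
  norm_num
  linear_combination (12 * Real.sin h) * Real.sin_sq_add_cos_sq h

lemma hasDerivAt_cos_quartic (c h : ℝ) :
    HasDerivAt (fun u => Real.cos u ^ 4 - 4 * c * Real.cos u + 3)
      (4 * Real.sin h * (c - Real.cos h ^ 3)) h := by
  refine ((((Real.hasDerivAt_cos h).fun_pow 4).fun_sub
    ((Real.hasDerivAt_cos h).const_mul (4 * c))).add_const 3).congr_deriv ?_
  norm_num
  ring

lemma divergence_kk_zero (c : ℝ) {x : Pt} (hs : Real.sin (x 1) ≠ 0) (a : Fin 3) :
    (∑ b, ∑ e, h0inv x b e * covD (kk c 0) x e a b) = 0 := by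
  have hC := (Real.cosh_pos (x 0)).ne'
  have h20 : pd 0 (fun y => kk c 0 y 2 0) x = _ :=
    pd_eq_const_mul (2 * (c - Real.cos (x 1))) (hasDerivAt_inv_cosh (x 0))
      fun s => by simp [kk]; ring
  have h21 : pd 1 (fun y => kk c 0 y 2 1) x = _ :=
    pd_eq_const_mul (Real.sinh (x 0) / 2)
      ((hasDerivAt_cos_quadratic c (x 1)).div_sin_pow hs 0) fun s => by simp [kk]; ring
  have h00 : pd 0 (fun y => kk c 0 y 0 0) x = 0 :=
    pd_eq_zero_of_const fun s => by simp [kk]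
  have h01 : pd 1 (fun y => kk c 0 y 0 1) x = 0 :=
    pd_eq_zero_of_const fun s => by simp [kk]
  have h02 : pd 2 (fun y => kk c 0 y 0 2) x = 0 :=
    pd_eq_zero_of_const fun s => by simp [kk]
  have h10 : pd 0 (fun y => kk c 0 y 1 0) x = 0 :=
    pd_eq_zero_of_const fun s => by simp [kk]
  have h11 : pd 1 (fun y => kk c 0 y 1 1) x = 0 :=
    pd_eq_zero_of_const fun s => by simp [kk]
  have h12 : pd 2 (fun y => kk c 0 y 1 2) x = 0 :=
    pd_eq_zero_of_const fun s => by simp [kk]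
  have h22 : pd 2 (fun y => kk c 0 y 2 2) x = 0 :=
    pd_eq_zero_of_const fun s => by simp [kk]
  rw [sum_h0inv_mul_covD h00 h01 h02 h10 h11 h12 h20 h21 h22]
  have hS := Real.cosh_sq (x 0)
  have hsc := Real.sin_sq_add_cos_sq (x 1)
  fin_cases a <;>
    simp [Fin.sum_univ_three, h0inv, Chr, kk, Real.tanh_eq_sinh_div_cosh, Real.cos_two_mul]
  field_simp
  grind

lemma divergence_kk_one (c : ℝ) {x : Pt} (hs : Real.sin (x 1) ≠ 0) (a : Fin 3) :
    (∑ b, ∑ e, h0inv x b e * covD (kk c 1) x e a b) = 0 := by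
  have hC := (Real.cosh_pos (x 0)).ne'
  have h20 : pd 0 (fun y => kk c 1 y 2 0) x = _ :=
    pd_eq_const_mul (-3 * Real.sin (x 1) ^ 2) (hasDerivAt_tanh_div_cosh (x 0))
      fun s => by simp [kk]; ring
  have h21 : pd 1 (fun y => kk c 1 y 2 1) x = _ :=
    pd_eq_const_mul (Real.cosh (x 0) / 4)
      ((hasDerivAt_cos_cubic c (x 1)).div_sin_pow hs 0) fun s => by simp [kk]; ring
  have h00 : pd 0 (fun y => kk c 1 y 0 0) x = 0 :=
    pd_eq_zero_of_const fun s => by simp [kk]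
  have h01 : pd 1 (fun y => kk c 1 y 0 1) x = 0 :=
    pd_eq_zero_of_const fun s => by simp [kk]
  have h02 : pd 2 (fun y => kk c 1 y 0 2) x = 0 :=
    pd_eq_zero_of_const fun s => by simp [kk]
  have h10 : pd 0 (fun y => kk c 1 y 1 0) x = 0 :=
    pd_eq_zero_of_const fun s => by simp [kk]
  have h11 : pd 1 (fun y => kk c 1 y 1 1) x = 0 :=
    pd_eq_zero_of_const fun s => by simp [kk]
  have h12 : pd 2 (fun y => kk c 1 y 1 2) x = 0 :=
    pd_eq_zero_of_const fun s => by simp [kk]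
  have h22 : pd 2 (fun y => kk c 1 y 2 2) x = 0 :=
    pd_eq_zero_of_const fun s => by simp [kk]
  rw [sum_h0inv_mul_covD h00 h01 h02 h10 h11 h12 h20 h21 h22]
  have hS := Real.cosh_sq (x 0)
  have hsc := Real.sin_sq_add_cos_sq (x 1)
  fin_cases a <;>
    simp [Fin.sum_univ_three, h0inv, Chr, kk, Real.tanh_eq_sinh_div_cosh, Real.cos_three_mul]
  field_simp
  grind

lemma divergence_kk_two (c : ℝ) {x : Pt} (hs : Real.sin (x 1) ≠ 0) (a : Fin 3) :
    (∑ b, ∑ e, h0inv x b e * covD (kk c 2) x e a b) = 0 := by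
  have hC := (Real.cosh_pos (x 0)).ne'
  have h02 : pd 2 (fun y => kk c 2 y 0 2) x = _ :=
    pd_eq_const_mul (3 * (Real.tanh (x 0) / Real.cosh (x 0)) * Real.cos (x 1) * Real.sin (x 1))
      (Real.hasDerivAt_cos (x 2)) fun s => by simp [kk]
  have h10 : pd 0 (fun y => kk c 2 y 1 0) x = _ :=
    pd_eq_const_mul (3 * Real.sin (x 2)) (hasDerivAt_tanh_div_cosh (x 0))
      fun s => by simp [kk]; ring
  have h11 : pd 1 (fun y => kk c 2 y 1 1) x = _ :=
    pd_eq_const_mul (-(Real.cosh (x 0) * Real.sin (x 2) / 2))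
      ((hasDerivAt_cos_cubic c (x 1)).div_sin_pow hs 2) fun s => by simp [kk]; ring
  have h12 : pd 2 (fun y => kk c 2 y 1 2) x = _ :=
    pd_eq_const_mul (Real.cosh (x 0) * (Real.cos (x 1) ^ 4 - 4 * c * Real.cos (x 1) + 3) /
      Real.sin (x 1) ^ 2) (Real.hasDerivAt_cos (x 2)) fun s => by simp [kk]; ring
  have h20 : pd 0 (fun y => kk c 2 y 2 0) x = _ :=
    pd_eq_const_mul (3 * Real.cos (x 1) * Real.sin (x 1) * Real.cos (x 2))
      (hasDerivAt_tanh_div_cosh (x 0)) fun s => by simp [kk]; ring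
  have h21 : pd 1 (fun y => kk c 2 y 2 1) x = _ :=
    pd_eq_const_mul (Real.cosh (x 0) * Real.cos (x 2))
      ((hasDerivAt_cos_quartic c (x 1)).div_sin_pow hs 1) fun s => by simp [kk]; ring
  have h22 : pd 2 (fun y => kk c 2 y 2 2) x = _ :=
    pd_eq_const_mul ((Real.cosh (x 0) *
      (-8 * c + 9 * Real.cos (x 1) - Real.cos (3 * x 1)) / (2 * Real.sin (x 1))))
      (Real.hasDerivAt_sin (x 2)) fun s => by simp [kk]; ring
  have h00 : pd 0 (fun y => kk c 2 y 0 0) x = 0 :=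
    pd_eq_zero_of_const fun s => by simp [kk]
  have h01 : pd 1 (fun y => kk c 2 y 0 1) x = 0 :=
    pd_eq_zero_of_const fun s => by simp [kk]
  rw [sum_h0inv_mul_covD h00 h01 h02 h10 h11 h12 h20 h21 h22]
  have hS := Real.cosh_sq (x 0)
  have hsc := Real.sin_sq_add_cos_sq (x 1)
  fin_cases a <;>
    simp [Fin.sum_univ_three, h0inv, Chr, kk, Real.tanh_eq_sinh_div_cosh, Real.cos_three_mul] <;>
    field_simp <;>
    grind

lemma divergence_kk_three (c : ℝ) {x : Pt} (hs : Real.sin (x 1) ≠ 0) (a : Fin 3) :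
    (∑ b, ∑ e, h0inv x b e * covD (kk c 3) x e a b) = 0 := by
  have hC := (Real.cosh_pos (x 0)).ne'
  have h02 : pd 2 (fun y => kk c 3 y 0 2) x = _ :=
    pd_eq_const_mul (3 * (Real.tanh (x 0) / Real.cosh (x 0)) * Real.cos (x 1) * Real.sin (x 1))
      (Real.hasDerivAt_sin (x 2)) fun s => by simp [kk]
  have h10 : pd 0 (fun y => kk c 3 y 1 0) x = _ :=
    pd_eq_const_mul (-3 * Real.cos (x 2)) (hasDerivAt_tanh_div_cosh (x 0))
      fun s => by simp [kk]; ring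
  have h11 : pd 1 (fun y => kk c 3 y 1 1) x = _ :=
    pd_eq_const_mul ((Real.cosh (x 0) * Real.cos (x 2) / 2))
      ((hasDerivAt_cos_cubic c (x 1)).div_sin_pow hs 2) fun s => by simp [kk]; ring
  have h12 : pd 2 (fun y => kk c 3 y 1 2) x = _ :=
    pd_eq_const_mul (Real.cosh (x 0) * (Real.cos (x 1) ^ 4 - 4 * c * Real.cos (x 1) + 3) /
      Real.sin (x 1) ^ 2) (Real.hasDerivAt_sin (x 2)) fun s => by simp [kk]; ring
  have h20 : pd 0 (fun y => kk c 3 y 2 0) x = _ :=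
    pd_eq_const_mul (3 * Real.cos (x 1) * Real.sin (x 1) * Real.sin (x 2))
      (hasDerivAt_tanh_div_cosh (x 0)) fun s => by simp [kk]; ring
  have h21 : pd 1 (fun y => kk c 3 y 2 1) x = _ :=
    pd_eq_const_mul (Real.cosh (x 0) * Real.sin (x 2))
      ((hasDerivAt_cos_quartic c (x 1)).div_sin_pow hs 1) fun s => by simp [kk]; ring
  have h22 : pd 2 (fun y => kk c 3 y 2 2) x = _ :=
    pd_eq_const_mul (-(Real.cosh (x 0) *
      (-8 * c + 9 * Real.cos (x 1) - Real.cos (3 * x 1)) / (2 * Real.sin (x 1))))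
      (Real.hasDerivAt_cos (x 2)) fun s => by simp [kk]; ring
  have h00 : pd 0 (fun y => kk c 3 y 0 0) x = 0 :=
    pd_eq_zero_of_const fun s => by simp [kk]
  have h01 : pd 1 (fun y => kk c 3 y 0 1) x = 0 :=
    pd_eq_zero_of_const fun s => by simp [kk]
  rw [sum_h0inv_mul_covD h00 h01 h02 h10 h11 h12 h20 h21 h22]
  have hS := Real.cosh_sq (x 0)
  have hsc := Real.sin_sq_add_cos_sq (x 1)
  fin_cases a <;>
    simp [Fin.sum_univ_three, h0inv, Chr, kk, Real.tanh_eq_sinh_div_cosh, Real.cos_three_mul] <;>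
    field_simp <;>
    grind

lemma trace_kk (μ : Fin 4) (c : ℝ) {x : Pt} (hs : Real.sin (x 1) ≠ 0) :
    (∑ a, ∑ b, h0inv x a b * kk c μ x a b) = 0 := by
  have hC := (Real.cosh_pos (x 0)).ne'
  fin_cases μ <;> simp [Fin.sum_univ_three, h0inv, kk] <;> field_simp <;> ring

/-- Each singular representative `k_{(μ)ab}` is traceless and divergence-free on `U`,
for every value of the parameter `c`. -/
theorem stmt11 : ∀ (μ : Fin 4) (c : ℝ), ∀ x ∈ U,
    (∑ a, ∑ b, h0inv x a b * kk c μ x a b) = 0 ∧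
    (∀ a : Fin 3, (∑ b, ∑ d, h0inv x b d * covD (kk c μ) x d a b) = 0) := by
  intro μ c x hx
  have hs : Real.sin (x 1) ≠ 0 := (Real.sin_pos_of_pos_of_lt_pi hx.1 hx.2).ne'
  refine ⟨trace_kk μ c hs, fun a => ?_⟩
  fin_cases μ
  · exact divergence_kk_zero c hs a
  · exact divergence_kk_one c hs a
  · exact divergence_kk_two c hs a
  · exact divergence_kk_three c hs a
end
end
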